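/- Let ρ be a normalized state on registers A, B, C and let α ∈ (0,1)∪(1,∞). Set η_A = ρ_A^α / Tr[ρ_A^α] and η_ABC = η_A^{1/2}·ρ_{BC|A}·η_A^{1/2}. Then the exact identity H_α↑(A|BC)_ρ = H_α↑(A|B)_ρ − I_α↓,diff(A;C|B)_η holds. Moreover, if ρ' is a normalized state on registers R, A and 𝒩: R → BC is a quantum channel with ρ_ABC = 𝒩(ρ'_RA), then H_α↑(A|B)_{𝒩(ρ')} − sup over normalized states ω on R, A of I_α↓,diff(A;C|B)_{𝒩(ω)} ≤ H_α↑(A|BC)_{𝒩(ρ')} ≤ H_α↑(A|B)_{𝒩(ρ')} − inf over normalized states ω on R, A of I_α↓,diff(A;C|B)_{𝒩(ω)}. -/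

import Mathlib

open scoped Kronecker
open Matrix
open scoped ComplexOrder

noncomputable section
namespace QITLeak

variable {A B : Type*}

/-- Real matrix power via spectral decomposition (Moore–Penrose pseudoinverse powers,
since `(0:ℝ) ^ (p:ℝ) = 0` for `p ≠ 0`). Junk value `0` on non-Hermitian input. -/
noncomputable def mpow [Fintype A] [DecidableEq A] (ρ : Matrix A A ℂ) (p : ℝ) :
    Matrix A A ℂ :=
  if hρ : ρ.IsHermitian then
    (hρ.eigenvectorUnitary : Matrix A A ℂ) *
      Matrix.diagonal (fun i => ((hρ.eigenvalues i ^ p : ℝ) : ℂ)) *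
      (star (hρ.eigenvectorUnitary : Matrix A A ℂ))
  else 0

/-- A normalized state (density matrix). -/
def IsState [Fintype A] (ρ : Matrix A A ℂ) : Prop := ρ.PosSemidef ∧ ρ.trace = 1

/-- A subnormalized state. -/
def IsSubState [Fintype A] (ρ : Matrix A A ℂ) : Prop := ρ.PosSemidef ∧ (ρ.trace).re ≤ 1

/-- Partial trace over the second tensor factor. -/
def ptB [Fintype B] (ρ : Matrix (A × B) (A × B) ℂ) : Matrix A A ℂ :=
  Matrix.of fun a a' => ∑ b, ρ (a, b) (a', b)

/-- Partial trace over the first tensor factor. -/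
def ptA [Fintype A] (ρ : Matrix (A × B) (A × B) ℂ) : Matrix B B ℂ :=
  Matrix.of fun b b' => ∑ a, ρ (a, b) (a, b')

/-- Partial trace over the factor `B`, along a decomposition `X ≃ A × B` of the registers. -/
def traceOut {X A B : Type*} [Fintype B] (e : X ≃ A × B) (ρ : Matrix X X ℂ) :
    Matrix A A ℂ :=
  Matrix.of fun a a' => ∑ b, ρ (e.symm (a, b)) (e.symm (a', b))

/-- Support inclusion `supp ρ ⊆ supp σ` (for PSD matrices: kernel inclusion). -/
def suppSubset [Fintype A] (ρ σ : Matrix A A ℂ) : Prop :=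
  ∀ v : A → ℂ, σ *ᵥ v = 0 → ρ *ᵥ v = 0

/-- The real-valued core formula of the sandwiched Rényi divergence (base 2). -/
def DR (α : ℝ) [Fintype A] [DecidableEq A] (ρ σ : Matrix A A ℂ) : ℝ :=
  (α - 1)⁻¹ * Real.logb 2
    (((mpow (mpow σ ((1 - α) / (2 * α)) * ρ * mpow σ ((1 - α) / (2 * α))) α).trace.re)
      / (ρ.trace).re)

open scoped Classical in
/-- The sandwiched Rényi divergence `D_α(ρ‖σ)`, with value `⊤` outside the
support/orthogonality conditions. -/
def D (α : ℝ) [Fintype A] [DecidableEq A] (ρ σ : Matrix A A ℂ) : EReal :=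
  if (α < 1 ∧ ¬ (ρ * σ = 0 ∧ σ * ρ = 0)) ∨ suppSubset ρ σ then ((DR α ρ σ : ℝ) : EReal)
  else ⊤

/-- The max-divergence `D_∞(ρ‖σ)`: log of the least `μ ≥ 0` with `ρ ≤ μσ` (`⊤` if none). -/
def Dmax [Fintype A] (ρ σ : Matrix A A ℂ) : EReal :=
  sInf {x : EReal | ∃ μ : ℝ, 0 ≤ μ ∧ (μ • σ - ρ).PosSemidef ∧ x = ((Real.logb 2 μ : ℝ) : EReal)}

section Ent
variable [Fintype A] [DecidableEq A] [Fintype B] [DecidableEq B]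

/-- `H_α↑(A|B)_ρ` for `ρ` on `A × B`. -/
def HUp (α : ℝ) (ρ : Matrix (A × B) (A × B) ℂ) : EReal :=
  - sInf {x : EReal | ∃ σ : Matrix B B ℂ, IsState σ ∧ x = D α ρ ((1 : Matrix A A ℂ) ⊗ₖ σ)}

/-- `H_α(A|B)_ρ` for `ρ` on `A × B`. -/
def Hdn (α : ℝ) (ρ : Matrix (A × B) (A × B) ℂ) : EReal :=
  - D α ρ ((1 : Matrix A A ℂ) ⊗ₖ ptA ρ)

/-- `I_α↓(A;B)_ρ` for `ρ` on `A × B`. -/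
def Idown (α : ℝ) (ρ : Matrix (A × B) (A × B) ℂ) : EReal :=
  sInf {x : EReal | ∃ σ : Matrix B B ℂ, IsState σ ∧ x = D α ρ ((ptB ρ) ⊗ₖ σ)}

/-- `I_α(A:B)_ρ` for `ρ` on `A × B`. -/
def Imut (α : ℝ) (ρ : Matrix (A × B) (A × B) ℂ) : EReal :=
  D α ρ ((ptB ρ) ⊗ₖ (ptA ρ))

/-- `I_α↓↓(A:B)_ρ` for `ρ` on `A × B`. -/
def Idd (α : ℝ) (ρ : Matrix (A × B) (A × B) ℂ) : EReal :=
  sInf {x : EReal | ∃ (ω : Matrix A A ℂ) (σ : Matrix B B ℂ),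
    IsState ω ∧ IsState σ ∧ x = D α ρ (ω ⊗ₖ σ)}

/-- `H_min↑(A|B)_ρ = H_∞↑(A|B)_ρ`. -/
def HminUp (ρ : Matrix (A × B) (A × B) ℂ) : EReal :=
  - sInf {x : EReal | ∃ σ : Matrix B B ℂ, IsState σ ∧ x = Dmax ρ ((1 : Matrix A A ℂ) ⊗ₖ σ)}

/-- `I_∞↓(A;B)_ρ`. -/
def ImaxD (ρ : Matrix (A × B) (A × B) ℂ) : EReal :=
  sInf {x : EReal | ∃ σ : Matrix B B ℂ, IsState σ ∧ x = Dmax ρ ((ptB ρ) ⊗ₖ σ)}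

/-- `I_∞(A:B)_ρ` (unoptimized max-information). -/
def ImaxND (ρ : Matrix (A × B) (A × B) ℂ) : EReal :=
  Dmax ρ ((ptB ρ) ⊗ₖ (ptA ρ))

/-- `I_∞↓↓(A:B)_ρ`. -/
def IddMax (ρ : Matrix (A × B) (A × B) ℂ) : EReal :=
  sInf {x : EReal | ∃ (ω : Matrix A A ℂ) (σ : Matrix B B ℂ),
    IsState ω ∧ IsState σ ∧ x = Dmax ρ (ω ⊗ₖ σ)}

end Ent

/-- Trace norm. -/
def traceNorm [Fintype A] [DecidableEq A] (M : Matrix A A ℂ) : ℝ :=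
  (mpow (Mᴴ * M) (1 / 2 : ℝ)).trace.re

/-- Generalized fidelity of subnormalized states. -/
def gFid [Fintype A] [DecidableEq A] (ρ σ : Matrix A A ℂ) : ℝ :=
  traceNorm (mpow ρ (1 / 2 : ℝ) * mpow σ (1 / 2 : ℝ)) +
    Real.sqrt ((1 - ρ.trace.re) * (1 - σ.trace.re))

/-- Purified distance. -/
def pDist [Fintype A] [DecidableEq A] (ρ σ : Matrix A A ℂ) : ℝ :=
  Real.sqrt (1 - gFid ρ σ ^ 2)

section Smooth
variable [Fintype A] [DecidableEq A] [Fintype B] [DecidableEq B]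

/-- Smoothed min-entropy `H_min↑,ε(A|B)_ρ`. -/
def HminUpEps (ε : ℝ) (ρ : Matrix (A × B) (A × B) ℂ) : EReal :=
  sSup {x : EReal | ∃ ρ' : Matrix (A × B) (A × B) ℂ,
    IsSubState ρ' ∧ pDist ρ' ρ ≤ ε ∧ x = HminUp ρ'}

/-- Smoothed max-information `I_max↓,ε(A;B)_ρ`. -/
def ImaxDEps (ε : ℝ) (ρ : Matrix (A × B) (A × B) ℂ) : EReal :=
  sInf {x : EReal | ∃ ρ' : Matrix (A × B) (A × B) ℂ,
    IsSubState ρ' ∧ pDist ρ' ρ ≤ ε ∧ x = ImaxD ρ'}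

/-- Smoothed (unoptimized) max-information `I_max^ε(A:B)_ρ`. -/
def ImaxNDEps (ε : ℝ) (ρ : Matrix (A × B) (A × B) ℂ) : EReal :=
  sInf {x : EReal | ∃ ρ' : Matrix (A × B) (A × B) ℂ,
    IsSubState ρ' ∧ pDist ρ' ρ ≤ ε ∧ x = ImaxND ρ'}

/-- Smoothed max-information `I_max↓↓,ε(A:B)_ρ`. -/
def IddMaxEps (ε : ℝ) (ρ : Matrix (A × B) (A × B) ℂ) : EReal :=
  sInf {x : EReal | ∃ ρ' : Matrix (A × B) (A × B) ℂ,
    IsSubState ρ' ∧ pDist ρ' ρ ≤ ε ∧ x = IddMax ρ'}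

/-- Smoothed Rényi conditional entropy `H_α↑,ε(A|B)_ρ`. -/
def HUpEps (α ε : ℝ) (ρ : Matrix (A × B) (A × B) ℂ) : EReal :=
  sSup {x : EReal | ∃ ρ' : Matrix (A × B) (A × B) ℂ,
    IsSubState ρ' ∧ pDist ρ' ρ ≤ ε ∧ x = HUp α ρ'}

end Smooth

/-- Extension `id_R ⊗ Φ` of a linear map on matrices, with a spectator register on the left. -/
def lext {R A B : Type*} (Φ : Matrix A A ℂ →ₗ[ℂ] Matrix B B ℂ) :
    Matrix (R × A) (R × A) ℂ →ₗ[ℂ] Matrix (R × B) (R × B) ℂ where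
  toFun ρ := Matrix.of fun p q => Φ (Matrix.of fun a a' => ρ (p.1, a) (q.1, a')) p.2 q.2
  map_add' x y := by
    ext p q
    show Φ ((Matrix.of fun a a' => x (p.1, a) (q.1, a'))
        + (Matrix.of fun a a' => y (p.1, a) (q.1, a'))) p.2 q.2 = _
    rw [map_add]; rfl
  map_smul' c x := by
    ext p q
    show Φ (c • (Matrix.of fun a a' => x (p.1, a) (q.1, a'))) p.2 q.2 = _
    rw [_root_.map_smul]; rfl

/-- Extension `Φ ⊗ id_R` of a linear map on matrices, with a spectator register on the right. -/
def rext {A B R : Type*} (Φ : Matrix A A ℂ →ₗ[ℂ] Matrix B B ℂ) :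
    Matrix (A × R) (A × R) ℂ →ₗ[ℂ] Matrix (B × R) (B × R) ℂ where
  toFun ρ := Matrix.of fun p q => Φ (Matrix.of fun a a' => ρ (a, p.2) (a', q.2)) p.1 q.1
  map_add' x y := by
    ext p q
    show Φ ((Matrix.of fun a a' => x (a, p.2) (a', q.2))
        + (Matrix.of fun a a' => y (a, p.2) (a', q.2))) p.1 q.1 = _
    rw [map_add]; rfl
  map_smul' c x := by
    ext p q
    show Φ (c • (Matrix.of fun a a' => x (a, p.2) (a', q.2))) p.1 q.1 = _
    rw [_root_.map_smul]; rfl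

/-- Completely positive trace-preserving map (quantum channel). -/
structure IsCPTP {A B : Type*} [Fintype A] [Fintype B]
    (Φ : Matrix A A ℂ →ₗ[ℂ] Matrix B B ℂ) : Prop where
  cp : ∀ (n : ℕ) (ρ : Matrix (Fin n × A) (Fin n × A) ℂ), ρ.PosSemidef →
    ((lext Φ) ρ).PosSemidef
  tp : ∀ ρ : Matrix A A ℂ, (Φ ρ).trace = ρ.trace

/-- The rank-one (pure) state associated to a vector. -/
def pureState {A : Type*} (ψ : A → ℂ) : Matrix A A ℂ := Matrix.vecMulVec ψ (star ψ)


/-! ## Statement 10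
Exact identity `H_α↑(A|BC)_ρ = H_α↑(A|B)_ρ − I_α↓,diff(A;C|B)_η` and the channel-relaxed
two-sided bounds. States are arranged on `A × (B × C)`. -/

/-- Register shuffle `A × (B × C) ≃ (A × B) × C` (trace out `C`). -/
def eAB_C (A B C : Type*) : A × (B × C) ≃ (A × B) × C where
  toFun x := ((x.1, x.2.1), x.2.2)
  invFun y := (y.1.1, (y.1.2, y.2))
  left_inv _ := rfl
  right_inv _ := rfl

/-- `I_α↓,diff(A;C|B)_τ = I_α↓(A;CB)_τ − I_α↓(A;B)_τ` for `τ` on `A × (B × C)`. -/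
noncomputable def IdiffACgB {A B C : Type*} [Fintype A] [DecidableEq A]
    [Fintype B] [DecidableEq B] [Fintype C] [DecidableEq C]
    (α : ℝ) (τ : Matrix (A × (B × C)) (A × (B × C)) ℂ) : EReal :=
  Idown α τ - Idown α (traceOut (eAB_C A B C) τ)

section PowerCalculus

variable {n m : Type*} [Fintype n] [DecidableEq n] [Fintype m] [DecidableEq m]

theorem mpow_mul_of_mul_eq {M U : Matrix n n ℂ} (hM : M.IsHermitian) (d : n → ℝ)
    (h : M * U = U * diagonal (fun i => (d i : ℂ))) (p : ℝ) :
    mpow M p * U = U * diagonal (fun i => ((d i ^ p : ℝ) : ℂ)) := by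
  set V : Matrix n n ℂ := hM.eigenvectorUnitary.1 with hV
  have hVV : star V * V = 1 := Unitary.coe_star_mul_self hM.eigenvectorUnitary
  have hVV' : V * star V = 1 := Unitary.coe_mul_star_self hM.eigenvectorUnitary
  have hspec : M = V * diagonal (fun i => (hM.eigenvalues i : ℂ)) * star V := by
    have := hM.spectral_theorem
    rw [Unitary.conjStarAlgAut_apply] at this
    exact this
  have hW : diagonal (fun i => (hM.eigenvalues i : ℂ)) * (star V * U)
      = (star V * U) * diagonal (fun i => (d i : ℂ)) := by
    calc _ = star V * V * diagonal (fun i => (hM.eigenvalues i : ℂ)) * (star V * U) := by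
          rw [hVV, one_mul]
      _ = star V * ((V * diagonal (fun i => (hM.eigenvalues i : ℂ)) * star V) * U) := by
          simp only [Matrix.mul_assoc]
      _ = _ := by rw [← hspec, h, Matrix.mul_assoc]
  have hW' : diagonal (fun i => ((hM.eigenvalues i ^ p : ℝ) : ℂ)) * (star V * U)
      = (star V * U) * diagonal (fun i => ((d i ^ p : ℝ) : ℂ)) := by
    ext i j
    have hij := congrFun (congrFun hW i) j
    rw [diagonal_mul, mul_diagonal, mul_comm] at hij
    rw [diagonal_mul, mul_diagonal, mul_comm]
    by_cases h0 : (star V * U) i j = 0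
    · rw [h0, zero_mul, zero_mul]
    · have := mul_left_cancel₀ h0 hij
      rw [Complex.ofReal_inj] at this
      rw [this]
  rw [mpow, dif_pos hM, ← hV, Matrix.mul_assoc, Matrix.mul_assoc, hW', ← Matrix.mul_assoc,
    ← Matrix.mul_assoc, hVV', one_mul]

theorem isHermitian_conj_diagonal (U : Matrix n n ℂ) (d : n → ℝ) :
    (U * diagonal (fun i => (d i : ℂ)) * Uᴴ).IsHermitian := by
  apply isHermitian_mul_mul_conjTranspose
  rw [IsHermitian, diagonal_conjTranspose]
  congr 1
  ext i
  simp

theorem mpow_conj_diagonal {U : Matrix n n ℂ} (hU : Uᴴ * U = 1) (d : n → ℝ) (p : ℝ) :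
    mpow (U * diagonal (fun i => (d i : ℂ)) * Uᴴ) p
      = U * diagonal (fun i => ((d i ^ p : ℝ) : ℂ)) * Uᴴ := by
  rw [← mpow_mul_of_mul_eq (isHermitian_conj_diagonal U d) d
    (by rw [Matrix.mul_assoc _ _ U, hU, mul_one]), Matrix.mul_assoc _ U Uᴴ,
    mul_eq_one_comm.mp hU, mul_one]

theorem exists_conj_diagonal {M : Matrix n n ℂ} (hM : M.PosSemidef) :
    ∃ (U : Matrix n n ℂ) (d : n → ℝ), Uᴴ * U = 1 ∧ (∀ i, 0 ≤ d i) ∧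
      M = U * diagonal (fun i => (d i : ℂ)) * Uᴴ := by
  refine ⟨hM.1.eigenvectorUnitary.1, hM.1.eigenvalues,
    Unitary.coe_star_mul_self hM.1.eigenvectorUnitary, hM.eigenvalues_nonneg, ?_⟩
  have := hM.1.spectral_theorem
  rw [Unitary.conjStarAlgAut_apply] at this
  exact this

theorem conj_diagonal_mul_conj_diagonal {U : Matrix n n ℂ} (hU : Uᴴ * U = 1) (d e : n → ℂ) :
    (U * diagonal d * Uᴴ) * (U * diagonal e * Uᴴ) = U * diagonal (fun i => d i * e i) * Uᴴ := by
  calc _ = U * (diagonal d * (Uᴴ * U) * diagonal e) * Uᴴ := by simp only [Matrix.mul_assoc]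
    _ = _ := by rw [hU, mul_one, diagonal_mul_diagonal]

theorem posSemidef_conj_diagonal (U : Matrix n n ℂ) {d : n → ℝ} (hd : ∀ i, 0 ≤ d i) :
    (U * diagonal (fun i => (d i : ℂ)) * Uᴴ).PosSemidef := by
  apply PosSemidef.mul_mul_conjTranspose_same
  exact PosSemidef.diagonal fun i => by simpa using hd i

theorem posSemidef_mpow {M : Matrix n n ℂ} (hM : M.PosSemidef) (p : ℝ) :
    (mpow M p).PosSemidef := by
  obtain ⟨U, d, hU, hd, rfl⟩ := exists_conj_diagonal hM
  rw [mpow_conj_diagonal hU]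
  exact posSemidef_conj_diagonal U fun i => Real.rpow_nonneg (hd i) p

theorem mpow_mul_mpow {M : Matrix n n ℂ} (hM : M.PosSemidef) {p q : ℝ} (h : p + q ≠ 0) :
    mpow M p * mpow M q = mpow M (p + q) := by
  obtain ⟨U, d, hU, hd, rfl⟩ := exists_conj_diagonal hM
  simp only [mpow_conj_diagonal hU, conj_diagonal_mul_conj_diagonal hU]
  simp only [Real.rpow_add' (hd _) h, Complex.ofReal_mul]

theorem mpow_mpow {M : Matrix n n ℂ} (hM : M.PosSemidef) (p q : ℝ) :
    mpow (mpow M p) q = mpow M (p * q) := by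
  obtain ⟨U, d, hU, hd, rfl⟩ := exists_conj_diagonal hM
  simp only [mpow_conj_diagonal hU, Real.rpow_mul (hd _)]

theorem mpow_exponent_one {M : Matrix n n ℂ} (hM : M.PosSemidef) : mpow M 1 = M := by
  obtain ⟨U, d, hU, hd, rfl⟩ := exists_conj_diagonal hM
  simp only [mpow_conj_diagonal hU, Real.rpow_one]

theorem mul_mpow_mul_mpow_neg {M : Matrix n n ℂ} (hM : M.PosSemidef) (p : ℝ) :
    M * (mpow M p * mpow M (-p)) = M := by
  obtain ⟨U, d, hU, hd, rfl⟩ := exists_conj_diagonal hM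
  simp only [mpow_conj_diagonal hU, conj_diagonal_mul_conj_diagonal hU]
  congr 3
  ext i
  rw [← Complex.ofReal_mul, ← Complex.ofReal_mul, Real.rpow_neg (hd i)]
  rcases (hd i).eq_or_lt with h | h
  · rw [← h, zero_mul]
  · rw [mul_inv_cancel₀ (Real.rpow_pos_of_pos h p).ne', mul_one]

theorem mpow_commute {M : Matrix n n ℂ} (hM : M.PosSemidef) (p q : ℝ) :
    mpow M p * mpow M q = mpow M q * mpow M p := by
  obtain ⟨U, d, hU, hd, rfl⟩ := exists_conj_diagonal hM
  simp only [mpow_conj_diagonal hU, conj_diagonal_mul_conj_diagonal hU, mul_comm]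

theorem mul_mpow_neg_mul_mpow {M : Matrix n n ℂ} (hM : M.PosSemidef) (q : ℝ) {p : ℝ}
    (hp : p ≠ 0) : mpow M q * (mpow M (-q) * mpow M p) = mpow M p := by
  obtain ⟨U, d, hU, hd, rfl⟩ := exists_conj_diagonal hM
  simp only [mpow_conj_diagonal hU, conj_diagonal_mul_conj_diagonal hU]
  congr 3
  ext i
  rcases (hd i).eq_or_lt with h0 | h0
  · simp [← h0, hp]
  · rw [← mul_assoc, ← Complex.ofReal_mul, ← Real.rpow_add h0, add_neg_cancel,
      Real.rpow_zero, Complex.ofReal_one, one_mul]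

theorem mpow_smul {M : Matrix n n ℂ} (hM : M.PosSemidef) {c : ℝ} (hc : 0 ≤ c) (p : ℝ) :
    mpow ((c : ℂ) • M) p = ((c ^ p : ℝ) : ℂ) • mpow M p := by
  obtain ⟨U, d, hU, hd, rfl⟩ := exists_conj_diagonal hM
  have h (a : ℝ) (e : n → ℝ) : (a : ℂ) • (U * diagonal (fun i => (e i : ℂ)) * Uᴴ)
      = U * diagonal (fun i => ((a * e i : ℝ) : ℂ)) * Uᴴ := by
    rw [← Matrix.smul_mul, ← Matrix.mul_smul, ← diagonal_smul]
    congr 3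
    ext i
    simp
  rw [h, mpow_conj_diagonal hU, mpow_conj_diagonal hU, h]
  simp only [Real.mul_rpow hc (hd _)]

theorem conj_diagonal_kronecker (U : Matrix n n ℂ) (V : Matrix m m ℂ) (d : n → ℝ) (e : m → ℝ) :
    (U * diagonal (fun i => (d i : ℂ)) * Uᴴ) ⊗ₖ (V * diagonal (fun i => (e i : ℂ)) * Vᴴ)
      = (U ⊗ₖ V) * diagonal (fun i : n × m => ((d i.1 * e i.2 : ℝ) : ℂ)) * (U ⊗ₖ V)ᴴ := by
  rw [mul_kronecker_mul, mul_kronecker_mul, conjTranspose_kronecker, diagonal_kronecker_diagonal]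
  simp only [Complex.ofReal_mul]

theorem kronecker_isometry {U : Matrix n n ℂ} {V : Matrix m m ℂ} (hU : Uᴴ * U = 1)
    (hV : Vᴴ * V = 1) : (U ⊗ₖ V)ᴴ * (U ⊗ₖ V) = 1 := by
  rw [conjTranspose_kronecker, ← mul_kronecker_mul, hU, hV, one_kronecker_one]

theorem mpow_kronecker {M : Matrix n n ℂ} {N : Matrix m m ℂ} (hM : M.PosSemidef)
    (hN : N.PosSemidef) (p : ℝ) : mpow (M ⊗ₖ N) p = mpow M p ⊗ₖ mpow N p := by
  obtain ⟨U, d, hU, hd, rfl⟩ := exists_conj_diagonal hM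
  obtain ⟨V, e, hV, he, rfl⟩ := exists_conj_diagonal hN
  simp only [conj_diagonal_kronecker, mpow_conj_diagonal hU, mpow_conj_diagonal hV,
    mpow_conj_diagonal (kronecker_isometry hU hV), Real.mul_rpow (hd _) (he _)]

theorem mpow_one (p : ℝ) : mpow (1 : Matrix n n ℂ) p = 1 := by
  have := mpow_conj_diagonal (U := (1 : Matrix n n ℂ)) (by simp) (fun _ => 1) p
  simpa using this

theorem trace_conj_diagonal {U : Matrix n n ℂ} (hU : Uᴴ * U = 1) (d : n → ℝ) :
    (U * diagonal (fun i => (d i : ℂ)) * Uᴴ).trace = ((∑ i, d i : ℝ) : ℂ) := by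
  rw [trace_mul_comm, ← Matrix.mul_assoc, hU, one_mul, trace_diagonal, Complex.ofReal_sum]

theorem trace_mpow_pos {M : Matrix n n ℂ} (hM : M.PosSemidef) (h : M ≠ 0) (p : ℝ) :
    0 < (mpow M p).trace.re := by
  obtain ⟨U, d, hU, hd, rfl⟩ := exists_conj_diagonal hM
  rw [mpow_conj_diagonal hU, trace_conj_diagonal hU, Complex.ofReal_re]
  have hex : ∃ i, d i ≠ 0 := by
    by_contra! h0
    exact h (by simp [h0])
  obtain ⟨i, hi⟩ := hex
  exact Finset.sum_pos' (fun j _ => Real.rpow_nonneg (hd j) p)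
    ⟨i, Finset.mem_univ i, Real.rpow_pos_of_pos ((hd i).lt_of_ne' hi) p⟩

theorem ofReal_trace_mpow {M : Matrix n n ℂ} (hM : M.PosSemidef) (p : ℝ) :
    ((mpow M p).trace.re : ℂ) = (mpow M p).trace := by
  obtain ⟨U, d, hU, hd, rfl⟩ := exists_conj_diagonal hM
  rw [mpow_conj_diagonal hU, trace_conj_diagonal hU, Complex.ofReal_re]

theorem mul_eq_zero_of_conj_eq_zero {M Q : Matrix n n ℂ} (hM : M.PosSemidef)
    (h : Qᴴ * M * Q = 0) : M * Q = 0 := by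
  have hS : (mpow M (1 / 2))ᴴ * mpow M (1 / 2) = M := by
    rw [(posSemidef_mpow hM _).1.eq, mpow_mul_mpow hM (by norm_num), add_halves,
      mpow_exponent_one hM]
  have : mpow M (1 / 2) * Q = 0 := by
    rw [← conjTranspose_mul_self_eq_zero, conjTranspose_mul, ← h]
    nth_rw 3 [← hS]
    simp only [Matrix.mul_assoc]
  rw [← hS, Matrix.mul_assoc, this, mul_zero]

theorem trace_contraction_le {U X : Matrix n n ℂ} (hU : Uᴴ * U = 1) (hX : X.PosSemidef)
    {d : n → ℝ} (hd : ∀ i, 0 ≤ d i) (hd1 : ∀ i, d i ≤ 1) :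
    ((U * diagonal (fun i => (d i : ℂ)) * Uᴴ) * X
      * (U * diagonal (fun i => (d i : ℂ)) * Uᴴ)).trace.re ≤ X.trace.re := by
  have hY : (Uᴴ * X * U).PosSemidef := hX.conjTranspose_mul_mul_same U
  have h1 : X.trace = (Uᴴ * X * U).trace := by
    rw [trace_mul_comm, ← Matrix.mul_assoc, mul_eq_one_comm.mp hU, one_mul]
  have h2 : ((U * diagonal (fun i => (d i : ℂ)) * Uᴴ) * X
      * (U * diagonal (fun i => (d i : ℂ)) * Uᴴ)).trace
      = ((Uᴴ * X * U) * diagonal (fun i => ((d i * d i : ℝ) : ℂ))).trace := by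
    rw [Matrix.mul_assoc, trace_mul_comm, Matrix.mul_assoc, conj_diagonal_mul_conj_diagonal hU,
      Matrix.mul_assoc U, ← Matrix.mul_assoc, trace_mul_comm]
    simp only [Matrix.mul_assoc, Complex.ofReal_mul]
    rw [trace_mul_comm]
    simp only [Matrix.mul_assoc]
  rw [h1, h2, trace, trace, Complex.re_sum, Complex.re_sum]
  refine Finset.sum_le_sum fun i _ => ?_
  rw [diag_apply, diag_apply, mul_diagonal, Complex.re_mul_ofReal]
  have h0 : 0 ≤ ((Uᴴ * X * U) i i).re := (Complex.nonneg_iff.mp hY.diag_nonneg).1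
  exact mul_le_of_le_one_right h0 (mul_le_one₀ (hd1 i) (hd i) (hd1 i))

theorem trace_mpow_le_card {M : Matrix n n ℂ} (hM : M.PosSemidef) (h : M.trace.re ≤ 1) {p : ℝ}
    (hp : 0 ≤ p) : (mpow M p).trace.re ≤ Fintype.card n := by
  obtain ⟨U, d, hU, hd, rfl⟩ := exists_conj_diagonal hM
  rw [trace_conj_diagonal hU, Complex.ofReal_re] at h
  rw [mpow_conj_diagonal hU, trace_conj_diagonal hU, Complex.ofReal_re]
  have hle (i : n) : d i ^ p ≤ 1 := Real.rpow_le_one (hd i)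
    ((Finset.single_le_sum (fun j _ => hd j) (Finset.mem_univ i)).trans h) hp
  simpa using Finset.sum_le_sum fun i (_ : i ∈ Finset.univ) => hle i

theorem le_trace_mpow [Nonempty n] {M : Matrix n n ℂ} (hM : M.PosSemidef) (h : 1 ≤ M.trace.re)
    {p : ℝ} (hp : 0 ≤ p) : ((Fintype.card n : ℝ)⁻¹) ^ p ≤ (mpow M p).trace.re := by
  obtain ⟨U, d, hU, hd, rfl⟩ := exists_conj_diagonal hM
  rw [trace_conj_diagonal hU, Complex.ofReal_re] at h
  rw [mpow_conj_diagonal hU, trace_conj_diagonal hU, Complex.ofReal_re]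
  obtain ⟨i, -, hi⟩ := Finset.exists_le_of_sum_le (s := Finset.univ)
    (f := fun _ : n => (Fintype.card n : ℝ)⁻¹) (g := d) Finset.univ_nonempty (by simpa using h)
  exact (Real.rpow_le_rpow (by positivity) hi hp).trans
    (Finset.single_le_sum (f := fun j => d j ^ p) (fun j _ => Real.rpow_nonneg (hd j) p)
      (Finset.mem_univ i))

end PowerCalculus

section PartialTrace

variable {n m : Type*} [Fintype n] [Fintype m] [DecidableEq m]

/-- Partial trace over the second factor, as a linear map. -/
def ptBLinear (B C : Type*) [Fintype C] : Matrix (B × C) (B × C) ℂ →ₗ[ℂ] Matrix B B ℂ where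
  toFun := ptB
  map_add' x y := by
    ext i j
    simp [ptB, Finset.sum_add_distrib]
  map_smul' c x := by
    ext i j
    simp [ptB, Finset.mul_sum]

theorem traceOut_eq_lext {A B C : Type*} [Fintype C]
    (τ : Matrix (A × (B × C)) (A × (B × C)) ℂ) :
    traceOut (eAB_C A B C) τ = lext (ptBLinear B C) τ := rfl

theorem trace_ptB {A B : Type*} [Fintype A] [Fintype B] (τ : Matrix (A × B) (A × B) ℂ) :
    (ptB τ).trace = τ.trace := by
  simp [ptB, trace, Fintype.sum_prod_type]

theorem ptB_lext {A X Y : Type*} [Fintype X] [Fintype Y]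
    {Φ : Matrix X X ℂ →ₗ[ℂ] Matrix Y Y ℂ} (hΦ : ∀ M, (Φ M).trace = M.trace)
    (τ : Matrix (A × X) (A × X) ℂ) : ptB (lext Φ τ) = ptB τ := by
  ext a a'
  exact hΦ (Matrix.of fun x x' => τ (a, x) (a', x'))

theorem posSemidef_ptB {A B : Type*} [Fintype B]
    {τ : Matrix (A × B) (A × B) ℂ} (hτ : τ.PosSemidef) :
    (ptB τ).PosSemidef := by
  have : ptB τ = ∑ b, τ.submatrix (fun a => (a, b)) (fun a => (a, b)) := by
    ext a a'
    simp [ptB, Matrix.sum_apply]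
  rw [this]
  exact posSemidef_sum _ fun b _ => hτ.submatrix _

theorem kronecker_one_mul_mul_apply (G H : Matrix n n ℂ) (τ : Matrix (n × m) (n × m) ℂ)
    (a a' : n) (x x' : m) :
    ((G ⊗ₖ (1 : Matrix m m ℂ)) * τ * (H ⊗ₖ (1 : Matrix m m ℂ))) (a, x) (a', x')
      = ∑ b', ∑ b, (G a b * H b' a') * τ (b, x) (b', x') := by
  simp only [Matrix.mul_apply, Fintype.sum_prod_type, kronecker_apply, one_apply, mul_ite,
    mul_one, mul_zero, ite_mul, zero_mul, Finset.sum_ite_eq, Finset.mem_univ, if_true, Finset.sum_mul]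
  refine Finset.sum_congr rfl fun b' _ => ?_
  rw [Finset.sum_comm]
  simp only [Finset.sum_ite_eq', Finset.mem_univ, if_true]
  exact Finset.sum_congr rfl fun b _ => by ring

theorem lext_kronecker_one {Y : Type*} [Fintype Y] [DecidableEq Y]
    (Φ : Matrix m m ℂ →ₗ[ℂ] Matrix Y Y ℂ) (G H : Matrix n n ℂ)
    (τ : Matrix (n × m) (n × m) ℂ) :
    lext Φ ((G ⊗ₖ (1 : Matrix m m ℂ)) * τ * (H ⊗ₖ (1 : Matrix m m ℂ)))
      = (G ⊗ₖ (1 : Matrix Y Y ℂ)) * lext Φ τ * (H ⊗ₖ (1 : Matrix Y Y ℂ)) := by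
  ext ⟨a, y⟩ ⟨a', y'⟩
  rw [kronecker_one_mul_mul_apply]
  have : (Matrix.of fun x x' =>
      ((G ⊗ₖ (1 : Matrix m m ℂ)) * τ * (H ⊗ₖ (1 : Matrix m m ℂ))) (a, x) (a', x'))
      = ∑ b', ∑ b, (G a b * H b' a') • (Matrix.of fun x x' => τ (b, x) (b', x')) := by
    ext x x'
    simp [kronecker_one_mul_mul_apply, Matrix.sum_apply]
  change Φ (Matrix.of fun x x' => _) y y' = _
  rw [this]
  simp only [map_sum, map_smul, Matrix.sum_apply, Matrix.smul_apply, smul_eq_mul]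
  rfl

theorem ptB_kronecker_one (G H : Matrix n n ℂ) (τ : Matrix (n × m) (n × m) ℂ) :
    ptB ((G ⊗ₖ (1 : Matrix m m ℂ)) * τ * (H ⊗ₖ (1 : Matrix m m ℂ))) = G * ptB τ * H := by
  ext a a'
  simp only [ptB, Matrix.of_apply, kronecker_one_mul_mul_apply]
  simp only [Matrix.mul_apply, Matrix.of_apply, Finset.sum_mul, Finset.mul_sum]
  rw [Finset.sum_comm]
  refine Finset.sum_congr rfl fun b' _ => ?_
  rw [Finset.sum_comm]
  exact Finset.sum_congr rfl fun b _ => Finset.sum_congr rfl fun x _ => by ring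

theorem mul_kronecker_one_eq_self [DecidableEq n] {τ : Matrix (n × m) (n × m) ℂ} (hτ : τ.PosSemidef)
    {P : Matrix n n ℂ} (hP : ptB τ * P = ptB τ) :
    τ * (P ⊗ₖ (1 : Matrix m m ℂ)) = τ := by
  have hQ : (((1 - P) ⊗ₖ (1 : Matrix m m ℂ))ᴴ * τ * ((1 - P) ⊗ₖ (1 : Matrix m m ℂ))) = 0 := by
    rw [← (hτ.conjTranspose_mul_mul_same _).trace_eq_zero_iff, ← trace_ptB,
      conjTranspose_kronecker, conjTranspose_one, ptB_kronecker_one, Matrix.mul_assoc,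
      Matrix.mul_sub, hP, mul_one, sub_self, mul_zero, trace_zero]
  have h := mul_eq_zero_of_conj_eq_zero hτ hQ
  have hs : (1 - P) ⊗ₖ (1 : Matrix m m ℂ) = 1 - P ⊗ₖ (1 : Matrix m m ℂ) := by
    rw [eq_sub_iff_add_eq, ← add_kronecker, sub_add_cancel, one_kronecker_one]
  rw [hs, Matrix.mul_sub, mul_one, sub_eq_zero] at h
  exact h.symm

end PartialTrace

section Divergence

variable {n m : Type*} [Fintype n] [DecidableEq n] [Fintype m] [DecidableEq m]

theorem mul_mpow_mul_mpow_neg_of_suppSubset {ρ σ : Matrix n n ℂ} (hσ : σ.PosSemidef)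
    (h : suppSubset ρ σ) (s : ℝ) : ρ * (mpow σ s * mpow σ (-s)) = ρ := by
  have hz : ρ * (1 - mpow σ s * mpow σ (-s)) = 0 := by
    have h0 : σ * (1 - mpow σ s * mpow σ (-s)) = 0 := by
      rw [Matrix.mul_sub, mul_one, mul_mpow_mul_mpow_neg hσ, sub_self]
    ext i j
    have := h (fun k => (1 - mpow σ s * mpow σ (-s)) k j) (by
      ext i
      exact congrFun (congrFun h0 i) j)
    exact congrFun this i
  rw [Matrix.mul_sub, mul_one, sub_eq_zero] at hz
  exact hz.symm

theorem suppSubset_of_mul_eq {A : Type*} [Fintype A] {ρ ρ' σ σ' X Y Z : Matrix A A ℂ}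
    (h : suppSubset ρ σ)
    (hσ : σ * Y = Z * σ') (hρ : X * ρ * Y = ρ') : suppSubset ρ' σ' := by
  intro v hv
  have h0 : ρ *ᵥ (Y *ᵥ v) = 0 := h _ (by
    rw [mulVec_mulVec, hσ, ← mulVec_mulVec, hv, mulVec_zero])
  rw [← hρ, ← mulVec_mulVec, ← mulVec_mulVec, h0, mulVec_zero]

theorem mul_eq_zero_of_mul_eq {A : Type*} [Fintype A] {ρ ρ' σ σ' X Y Z : Matrix A A ℂ}
    (h : ρ * σ = 0)
    (hσ : Y * σ' = σ * Z) (hρ : X * ρ * Y = ρ') : ρ' * σ' = 0 := by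
  rw [← hρ, Matrix.mul_assoc, hσ, Matrix.mul_assoc, ← Matrix.mul_assoc ρ, h, zero_mul, mul_zero]

theorem mul_eq_zero_and_iff {A : Type*} [Fintype A] {ρ σ : Matrix A A ℂ}
    (hρ : ρ.IsHermitian) (hσ : σ.IsHermitian) :
    ρ * σ = 0 ∧ σ * ρ = 0 ↔ ρ * σ = 0 := by
  refine ⟨And.left, fun h => ⟨h, ?_⟩⟩
  have := congrArg conjTranspose h
  rwa [conjTranspose_mul, hρ.eq, hσ.eq, conjTranspose_zero] at this

theorem sandwich_ne_zero {α : ℝ} {ρ σ : Matrix n n ℂ} (hρ : ρ.PosSemidef) (hρ0 : ρ ≠ 0)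
    (hσ : σ.PosSemidef)
    (h : (α < 1 ∧ ¬ (ρ * σ = 0 ∧ σ * ρ = 0)) ∨ suppSubset ρ σ) (s : ℝ) :
    mpow σ s * ρ * mpow σ s ≠ 0 := by
  intro h0
  have hz : ρ * mpow σ s = 0 := by
    apply mul_eq_zero_of_conj_eq_zero hρ
    rw [(posSemidef_mpow hσ s).1.eq, h0]
  rcases h with ⟨-, h⟩ | h
  · have h1 : ρ * σ = 0 := by
      have hh : mpow σ s * mpow σ (-s) * σ = σ := by
        have := congrArg conjTranspose (mul_mpow_mul_mpow_neg hσ s)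
        rwa [conjTranspose_mul, conjTranspose_mul, (posSemidef_mpow hσ s).1.eq,
          (posSemidef_mpow hσ (-s)).1.eq, hσ.1.eq, mpow_commute hσ] at this
      rw [← hh, ← Matrix.mul_assoc, ← Matrix.mul_assoc, hz, zero_mul, zero_mul]
    exact h ((mul_eq_zero_and_iff hρ.1 hσ.1).mpr h1)
  · apply hρ0
    rw [← mul_mpow_mul_mpow_neg_of_suppSubset hσ h s, ← Matrix.mul_assoc, hz, zero_mul]

theorem posSemidef_sandwich {ρ σ : Matrix n n ℂ} (hρ : ρ.PosSemidef) (hσ : σ.PosSemidef)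
    (s : ℝ) : (mpow σ s * ρ * mpow σ s).PosSemidef := by
  have := hρ.mul_mul_conjTranspose_same (mpow σ s)
  rwa [(posSemidef_mpow hσ s).1.eq] at this

theorem IsState.ne_zero {A : Type*} [Fintype A] {ρ : Matrix A A ℂ} (hρ : IsState ρ) : ρ ≠ 0 := by
  rintro rfl
  simpa using hρ.2

theorem exists_conj_diagonal_one_kronecker {σ : Matrix m m ℂ} (hσ : IsState σ) :
    ∃ (U : Matrix (n × m) (n × m) ℂ) (d : n × m → ℝ), Uᴴ * U = 1 ∧ (∀ i, 0 ≤ d i) ∧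
      (∀ i, d i ≤ 1) ∧
      (1 : Matrix n n ℂ) ⊗ₖ σ = U * diagonal (fun i => (d i : ℂ)) * Uᴴ := by
  obtain ⟨V, e, hV, he, rfl⟩ := exists_conj_diagonal hσ.1
  have htr := hσ.2
  rw [trace_conj_diagonal hV, Complex.ofReal_eq_one] at htr
  refine ⟨1 ⊗ₖ V, fun i => e i.2, kronecker_isometry (by simp) hV, fun i => he i.2, fun i => ?_, ?_⟩
  · exact htr ▸ Finset.single_le_sum (fun j _ => he j) (Finset.mem_univ i.2)
  · have := conj_diagonal_kronecker (1 : Matrix n n ℂ) V (fun _ => 1) e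
    simpa using this

theorem exists_forall_le_D_one_kronecker {α : ℝ} (hα : α ∈ Set.Ioo (0 : ℝ) 1 ∪ Set.Ioi (1 : ℝ))
    {ρ : Matrix (n × m) (n × m) ℂ} (hρ : IsState ρ) :
    ∃ b : ℝ, ∀ σ : Matrix m m ℂ, IsState σ →
      (b : EReal) ≤ D α ρ ((1 : Matrix n n ℂ) ⊗ₖ σ) := by
  have hne : Nonempty (n × m) := by
    by_contra h
    rw [not_nonempty_iff] at h
    exact hρ.ne_zero (Subsingleton.elim _ _)
  have hcard : (1 : ℝ) ≤ Fintype.card (n × m) := by exact_mod_cast Fintype.card_pos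
  rcases hα with ⟨h0, h1⟩ | h1
  · refine ⟨(α - 1)⁻¹ * Real.logb 2 (Fintype.card (n × m)), fun σ hσ => ?_⟩
    rw [D]
    split_ifs with hD
    swap
    · exact le_top
    have hτ : ((1 : Matrix n n ℂ) ⊗ₖ σ).PosSemidef := PosSemidef.one.kronecker hσ.1
    have hpos := trace_mpow_pos (posSemidef_sandwich hρ.1 hτ ((1 - α) / (2 * α)))
      (sandwich_ne_zero hρ.1 hρ.ne_zero hτ hD _) α
    have hle : (mpow ((1 : Matrix n n ℂ) ⊗ₖ σ) ((1 - α) / (2 * α)) * ρ *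
        mpow ((1 : Matrix n n ℂ) ⊗ₖ σ) ((1 - α) / (2 * α))).trace.re ≤ 1 := by
      obtain ⟨U, d, hU, hd, hd1, h⟩ := exists_conj_diagonal_one_kronecker (n := n) hσ
      have hs : 0 ≤ (1 - α) / (2 * α) := div_nonneg (by linarith) (by linarith)
      rw [h, mpow_conj_diagonal hU]
      refine (trace_contraction_le hU hρ.1 (fun i => Real.rpow_nonneg (hd i) _)
        fun i => Real.rpow_le_one (hd i) (hd1 i) hs).trans ?_
      rw [hρ.2, Complex.one_re]
    rw [EReal.coe_le_coe_iff, DR, hρ.2, Complex.one_re, div_one]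
    refine mul_le_mul_of_nonpos_left ?_ (inv_nonpos.mpr (by linarith))
    exact Real.logb_le_logb_of_le one_lt_two hpos
      (trace_mpow_le_card (posSemidef_sandwich hρ.1 hτ _) hle h0.le)
  · have h1 : 1 < α := h1
    refine ⟨(α - 1)⁻¹ * Real.logb 2 (((Fintype.card (n × m) : ℝ)⁻¹) ^ α), fun σ hσ => ?_⟩
    rw [D]
    split_ifs with hD
    swap
    · exact le_top
    have hsupp : suppSubset ρ ((1 : Matrix n n ℂ) ⊗ₖ σ) :=
      hD.resolve_left fun h => by linarith [h.1]
    have hτ : ((1 : Matrix n n ℂ) ⊗ₖ σ).PosSemidef := PosSemidef.one.kronecker hσ.1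
    set s := (1 - α) / (2 * α) with hs
    set τ := (1 : Matrix n n ℂ) ⊗ₖ σ with hτdef
    have hM := posSemidef_sandwich hρ.1 hτ s
    have hle : 1 ≤ (mpow τ s * ρ * mpow τ s).trace.re := by
      have hρeq : mpow τ (-s) * (mpow τ s * ρ * mpow τ s) * mpow τ (-s) = ρ := by
        have hr := mul_mpow_mul_mpow_neg_of_suppSubset hτ hsupp s
        have hl := congrArg conjTranspose hr
        rw [conjTranspose_mul, conjTranspose_mul, (posSemidef_mpow hτ s).1.eq,
          (posSemidef_mpow hτ (-s)).1.eq, hρ.1.1.eq] at hl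
        calc _ = (mpow τ (-s) * mpow τ s * ρ) * (mpow τ s * mpow τ (-s)) := by
              simp only [Matrix.mul_assoc]
          _ = ρ := by rw [hl, hr]
      obtain ⟨U, d, hU, hd, hd1, h⟩ := exists_conj_diagonal_one_kronecker (n := n) hσ
      have hs' : 0 ≤ -s := by
        rw [hs, ← neg_div]
        exact div_nonneg (by linarith) (by linarith)
      have hc := trace_contraction_le hU hM (fun i => Real.rpow_nonneg (hd i) (-s))
        fun i => Real.rpow_le_one (hd i) (hd1 i) hs'
      rw [← mpow_conj_diagonal hU, ← h, ← hτdef, hρeq, hρ.2, Complex.one_re] at hc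
      exact hc
    rw [EReal.coe_le_coe_iff, DR, hρ.2, Complex.one_re, div_one]
    refine mul_le_mul_of_nonneg_left ?_ (inv_nonneg.mpr (by linarith))
    exact Real.logb_le_logb_of_le one_lt_two (Real.rpow_pos_of_pos (by positivity) _)
      (le_trace_mpow hM hle (by linarith))

theorem exists_HUp_eq_coe {α : ℝ} (hα : α ∈ Set.Ioo (0 : ℝ) 1 ∪ Set.Ioi (1 : ℝ))
    {ρ : Matrix (n × m) (n × m) ℂ} (hρ : IsState ρ) : ∃ h : ℝ, HUp α ρ = h := by
  obtain ⟨b, hb⟩ := exists_forall_le_D_one_kronecker hα hρ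
  have hne : Nonempty m := by
    by_contra h
    rw [not_nonempty_iff] at h
    exact hρ.ne_zero (Subsingleton.elim _ _)
  have hcard : (Fintype.card m : ℂ) ≠ 0 := by exact_mod_cast Fintype.card_ne_zero
  set σ : Matrix m m ℂ := (Fintype.card m : ℂ)⁻¹ • 1 with hσdef
  have hσ : IsState σ := by
    refine ⟨PosSemidef.one.smul (by positivity), ?_⟩
    rw [hσdef, trace_smul, trace_one, smul_eq_mul, inv_mul_cancel₀ hcard]
  have hsupp : suppSubset ρ ((1 : Matrix n n ℂ) ⊗ₖ σ) := by
    intro v hv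
    rw [hσdef, kronecker_smul, one_kronecker_one, smul_mulVec, one_mulVec,
      smul_eq_zero_iff_right (inv_ne_zero hcard)] at hv
    rw [hv, mulVec_zero]
  have hfin : D α ρ ((1 : Matrix n n ℂ) ⊗ₖ σ) = (DR α ρ ((1 : Matrix n n ℂ) ⊗ₖ σ) : ℝ) :=
    if_pos (Or.inr hsupp)
  set S := {x : EReal | ∃ σ : Matrix m m ℂ, IsState σ ∧ x = D α ρ ((1 : Matrix n n ℂ) ⊗ₖ σ)}
    with hS
  have hlow : (b : EReal) ≤ sInf S := le_sInf (by
    rintro x ⟨σ, hσ, rfl⟩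
    exact hb σ hσ)
  have hup : sInf S ≤ (DR α ρ ((1 : Matrix n n ℂ) ⊗ₖ σ) : ℝ) := sInf_le ⟨σ, hσ, hfin.symm⟩
  refine ⟨-(sInf S).toReal, ?_⟩
  rw [HUp, ← hS, EReal.coe_neg, EReal.coe_toReal]
  · exact ne_top_of_le_ne_top (EReal.coe_ne_top _) hup
  · exact ne_bot_of_le_ne_bot (EReal.coe_ne_bot _) hlow

end Divergence

section Tilting

variable {n m : Type*} [Fintype n] [DecidableEq n] [Fintype m] [DecidableEq m]

/-- The state `ρ_A^{(α-1)/2} ρ_AX ρ_A^{(α-1)/2} / Tr ρ_A^α`, with the marginal `r = ρ_A` given. -/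
def tilt (α : ℝ) (r : Matrix n n ℂ) (ρ : Matrix (n × m) (n × m) ℂ) :
    Matrix (n × m) (n × m) ℂ :=
  (((mpow r α).trace.re⁻¹ : ℝ) : ℂ) •
    ((mpow r ((α - 1) / 2) ⊗ₖ (1 : Matrix m m ℂ)) * ρ *
      (mpow r ((α - 1) / 2) ⊗ₖ (1 : Matrix m m ℂ)))

theorem lext_tilt {Y : Type*} [Fintype Y] [DecidableEq Y] (Φ : Matrix m m ℂ →ₗ[ℂ] Matrix Y Y ℂ)
    (α : ℝ) (r : Matrix n n ℂ) (ρ : Matrix (n × m) (n × m) ℂ) :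
    lext Φ (tilt α r ρ) = tilt α r (lext Φ ρ) := by
  rw [tilt, map_smul, lext_kronecker_one, tilt]

theorem IsState.ptB {A B : Type*} [Fintype A] [Fintype B] {ρ : Matrix (A × B) (A × B) ℂ}
    (hρ : IsState ρ) :
    IsState (QITLeak.ptB ρ) :=
  ⟨posSemidef_ptB hρ.1, by rw [trace_ptB, hρ.2]⟩

theorem ptB_tilt {α : ℝ} (hα : α ≠ 0) {ρ : Matrix (n × m) (n × m) ℂ} (hρ : IsState ρ) :
    ptB (tilt α (ptB ρ) ρ)
      = (((mpow (ptB ρ) α).trace.re⁻¹ : ℝ) : ℂ) • mpow (ptB ρ) α := by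
  have hr := hρ.ptB.1
  have hsm (c : ℂ) (τ : Matrix (n × m) (n × m) ℂ) : ptB (c • τ) = c • ptB τ :=
    (ptBLinear n m).map_smul c τ
  rw [tilt, hsm, ptB_kronecker_one]
  congr 1
  set r := ptB ρ
  obtain ⟨U, d, hU, hd, hrd⟩ := exists_conj_diagonal hr
  rw [hrd, mpow_conj_diagonal hU, mpow_conj_diagonal hU, conj_diagonal_mul_conj_diagonal hU,
    conj_diagonal_mul_conj_diagonal hU]
  congr 3
  ext i
  rcases (hd i).eq_or_lt with h0 | h0
  · simp [← h0, hα]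
  · rw [← Complex.ofReal_mul, ← Complex.ofReal_mul, Complex.ofReal_inj,
      ← Real.rpow_add_one h0.ne', ← Real.rpow_add h0]
    congr 1
    ring

theorem IsState.tilt {α : ℝ} (hα : α ≠ 0) {ρ : Matrix (n × m) (n × m) ℂ} (hρ : IsState ρ) :
    IsState (tilt α (QITLeak.ptB ρ) ρ) := by
  have hr := hρ.ptB
  have hc := trace_mpow_pos hr.1 hr.ne_zero α
  constructor
  · have hG : (mpow (QITLeak.ptB ρ) ((α - 1) / 2) ⊗ₖ (1 : Matrix m m ℂ)).PosSemidef :=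
      (posSemidef_mpow hr.1 _).kronecker PosSemidef.one
    have := hρ.1.mul_mul_conjTranspose_same
      (mpow (QITLeak.ptB ρ) ((α - 1) / 2) ⊗ₖ (1 : Matrix m m ℂ))
    rw [hG.1.eq] at this
    exact this.smul (by simpa using hc.le)
  · rw [← trace_ptB, ptB_tilt hα hρ, trace_smul, ← ofReal_trace_mpow hr.1, smul_eq_mul,
      ← Complex.ofReal_mul, Complex.ofReal_re, inv_mul_cancel₀ hc.ne', Complex.ofReal_one]

theorem D_tilt {α : ℝ} (hα : 0 < α) (hα1 : α ≠ 1) {ρ : Matrix (n × m) (n × m) ℂ}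
    (hρ : IsState ρ) {σ : Matrix m m ℂ} (hσ : σ.PosSemidef) :
    D α (tilt α (ptB ρ) ρ) (ptB (tilt α (ptB ρ) ρ) ⊗ₖ σ)
      = D α ρ ((1 : Matrix n n ℂ) ⊗ₖ σ)
        + ((-((α - 1)⁻¹ * Real.logb 2 (mpow (ptB ρ) α).trace.re) : ℝ) : EReal) := by
  have hηtr := (hρ.tilt hα.ne').2
  rw [ptB_tilt hα.ne' hρ]
  have hr := hρ.ptB
  set η := tilt α (ptB ρ) ρ with hη
  set r := ptB ρ with hrdef
  set c := (mpow r α).trace.re with hc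
  have hc0 : 0 < c := trace_mpow_pos hr.1 hr.ne_zero α
  have hci0 : 0 < c⁻¹ := inv_pos.mpr hc0
  set K := mpow r ((α - 1) / 2) with hK
  set L := mpow r ((1 - α) / 2) with hL
  have hLneg : (1 - α) / 2 = -((α - 1) / 2) := by ring
  have hKL : K * L = L * K := mpow_commute hr.1 _ _
  have hρP : ρ * ((K * L) ⊗ₖ (1 : Matrix m m ℂ)) = ρ :=
    mul_kronecker_one_eq_self hρ.1 (by rw [hK, hL, hLneg, ← hrdef, mul_mpow_mul_mpow_neg hr.1])
  have hPρ : ((K * L) ⊗ₖ (1 : Matrix m m ℂ)) * ρ = ρ := by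
    have := congrArg conjTranspose hρP
    rwa [conjTranspose_mul, conjTranspose_kronecker, conjTranspose_one, conjTranspose_mul,
      (posSemidef_mpow hr.1 _).1.eq, (posSemidef_mpow hr.1 _).1.eq, hρ.1.1.eq, ← hKL] at this
  have hηρ : (((c⁻¹ : ℝ) : ℂ) • (K ⊗ₖ (1 : Matrix m m ℂ))) * ρ * (K ⊗ₖ (1 : Matrix m m ℂ)) = η := by
    rw [Matrix.smul_mul, Matrix.smul_mul]
    rfl
  have hρη : ((c : ℂ) • (L ⊗ₖ (1 : Matrix m m ℂ))) * η * (L ⊗ₖ (1 : Matrix m m ℂ)) = ρ := by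
    calc _ = ((c : ℂ) * ((c⁻¹ : ℝ) : ℂ)) • (((L ⊗ₖ (1 : Matrix m m ℂ)) *
          (K ⊗ₖ (1 : Matrix m m ℂ))) * ρ *
          ((K ⊗ₖ (1 : Matrix m m ℂ)) * (L ⊗ₖ (1 : Matrix m m ℂ)))) := by
          simp only [← hηρ, Matrix.mul_assoc, Matrix.smul_mul, Matrix.mul_smul, smul_smul]
          rw [mul_comm (c : ℂ)]
      _ = ρ := by
          rw [← mul_kronecker_mul, ← mul_kronecker_mul, mul_one, ← hKL, hPρ, hρP,
            ← Complex.ofReal_mul, mul_inv_cancel₀ hc0.ne', Complex.ofReal_one, one_smul]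
  have hηpsd := (hρ.tilt hα.ne').1
  have hτ : ((1 : Matrix n n ℂ) ⊗ₖ σ).PosSemidef := PosSemidef.one.kronecker hσ
  set e := ((c⁻¹ : ℝ) : ℂ) • mpow r α with he
  have hepsd : e.PosSemidef := (posSemidef_mpow hr.1 α).smul (by exact_mod_cast hci0.le)
  have heσ : (e ⊗ₖ σ).PosSemidef := hepsd.kronecker hσ
  have hcc : (c : ℂ) * ((c⁻¹ : ℝ) : ℂ) = 1 := by
    rw [← Complex.ofReal_mul, mul_inv_cancel₀ hc0.ne', Complex.ofReal_one]
  have hdivr {p : ℝ} (hp : p ≠ 0) : e * ((c : ℂ) • (mpow r (-α) * mpow r p)) = mpow r p := by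
    rw [he, Matrix.smul_mul, Matrix.mul_smul, smul_smul, mul_comm, hcc, one_smul,
      mul_mpow_neg_mul_mpow hr.1 _ hp]
  have hdivl {p : ℝ} (hp : p ≠ 0) : ((c : ℂ) • (mpow r (-α) * mpow r p)) * e = mpow r p := by
    have hcomm : mpow r (-α) * mpow r p * mpow r α = mpow r α * (mpow r (-α) * mpow r p) := by
      rw [Matrix.mul_assoc, mpow_commute hr.1 p, ← Matrix.mul_assoc, mpow_commute hr.1 (-α),
        Matrix.mul_assoc]
    rw [he, Matrix.smul_mul, Matrix.mul_smul, smul_smul, hcc, one_smul, hcomm,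
      mul_mpow_neg_mul_mpow hr.1 _ hp]
  have hp1 : (α - 1) / 2 ≠ 0 := div_ne_zero (sub_ne_zero.mpr hα1) two_ne_zero
  have hp2 : (1 - α) / 2 ≠ 0 := div_ne_zero (sub_ne_zero.mpr hα1.symm) two_ne_zero
  have hsupp : suppSubset η (e ⊗ₖ σ) ↔ suppSubset ρ ((1 : Matrix n n ℂ) ⊗ₖ σ) := by
    constructor
    · refine fun h => suppSubset_of_mul_eq (Z := (e * L) ⊗ₖ 1) h ?_ hρη
      simp only [← mul_kronecker_mul, mul_one, one_mul]
    · refine fun h => suppSubset_of_mul_eq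
        (Z := ((c : ℂ) • (mpow r (-α) * mpow r ((α - 1) / 2))) ⊗ₖ 1) h ?_ hηρ
      rw [← mul_kronecker_mul, ← mul_kronecker_mul, mul_one, one_mul, one_mul, hdivl hp1]
  have horth : (η * (e ⊗ₖ σ) = 0 ∧ (e ⊗ₖ σ) * η = 0) ↔
      (ρ * ((1 : Matrix n n ℂ) ⊗ₖ σ) = 0 ∧ ((1 : Matrix n n ℂ) ⊗ₖ σ) * ρ = 0) := by
    rw [mul_eq_zero_and_iff hηpsd.1 heσ.1, mul_eq_zero_and_iff hρ.1.1 hτ.1]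
    constructor
    · refine fun h => mul_eq_zero_of_mul_eq
        (Z := ((c : ℂ) • (mpow r (-α) * mpow r ((1 - α) / 2))) ⊗ₖ 1) h ?_ hρη
      rw [← mul_kronecker_mul, ← mul_kronecker_mul, mul_one, mul_one, one_mul, hdivr hp2]
    · refine fun h => mul_eq_zero_of_mul_eq (Z := (K * e) ⊗ₖ 1) h ?_ hηρ
      simp only [← mul_kronecker_mul, mul_one, one_mul]
  set s := (1 - α) / (2 * α) with hs
  have hsand : mpow (e ⊗ₖ σ) s * η * mpow (e ⊗ₖ σ) s = (((c⁻¹ ^ α⁻¹ : ℝ)) : ℂ) •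
      (mpow ((1 : Matrix n n ℂ) ⊗ₖ σ) s * ρ * mpow ((1 : Matrix n n ℂ) ⊗ₖ σ) s) := by
    have hes : mpow e s = ((c⁻¹ ^ s : ℝ) : ℂ) • L := by
      rw [he, mpow_smul (posSemidef_mpow hr.1 α) hci0.le, mpow_mpow hr.1]
      congr 2
      rw [hs]
      field_simp
    have hl : (L ⊗ₖ mpow σ s) * (K ⊗ₖ (1 : Matrix m m ℂ))
        = ((1 : Matrix n n ℂ) ⊗ₖ mpow σ s) * ((K * L) ⊗ₖ (1 : Matrix m m ℂ)) := by
      rw [← mul_kronecker_mul, ← mul_kronecker_mul, one_mul, mul_one, hKL]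
    have hr' : (K ⊗ₖ (1 : Matrix m m ℂ)) * (L ⊗ₖ mpow σ s)
        = ((K * L) ⊗ₖ (1 : Matrix m m ℂ)) * ((1 : Matrix n n ℂ) ⊗ₖ mpow σ s) := by
      rw [← mul_kronecker_mul, ← mul_kronecker_mul, one_mul, mul_one]
    have hpow : c⁻¹ ^ s * (c⁻¹ * c⁻¹ ^ s) = c⁻¹ ^ α⁻¹ := by
      rw [← Real.rpow_one_add' hci0.le, ← Real.rpow_add hci0]
      · congr 1
        rw [hs]
        field_simp
        ring
      · have : 1 + s = (1 + α) / (2 * α) := by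
          rw [hs]
          field_simp
          ring
        rw [this]
        positivity
    rw [mpow_kronecker hepsd hσ, mpow_kronecker PosSemidef.one hσ, mpow_one, hes, ← hηρ, ← hpow]
    simp only [smul_kronecker, Matrix.smul_mul, Matrix.mul_smul, smul_smul, Complex.ofReal_mul]
    congr 1
    calc _ = ((L ⊗ₖ mpow σ s) * (K ⊗ₖ (1 : Matrix m m ℂ))) * ρ *
          ((K ⊗ₖ (1 : Matrix m m ℂ)) * (L ⊗ₖ mpow σ s)) := by simp only [Matrix.mul_assoc]
      _ = ((1 : Matrix n n ℂ) ⊗ₖ mpow σ s) * ((((K * L) ⊗ₖ (1 : Matrix m m ℂ)) * ρ) *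
          ((K * L) ⊗ₖ (1 : Matrix m m ℂ))) * ((1 : Matrix n n ℂ) ⊗ₖ mpow σ s) := by
        rw [hl, hr']
        simp only [Matrix.mul_assoc]
      _ = _ := by rw [hPρ, hρP]
  have hcond : ((α < 1 ∧ ¬ (η * (e ⊗ₖ σ) = 0 ∧ (e ⊗ₖ σ) * η = 0)) ∨ suppSubset η (e ⊗ₖ σ)) ↔
      ((α < 1 ∧ ¬ (ρ * ((1 : Matrix n n ℂ) ⊗ₖ σ) = 0 ∧ ((1 : Matrix n n ℂ) ⊗ₖ σ) * ρ = 0)) ∨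
        suppSubset ρ ((1 : Matrix n n ℂ) ⊗ₖ σ)) := by
    rw [horth, hsupp]
  by_cases h : (α < 1 ∧
      ¬ (ρ * ((1 : Matrix n n ℂ) ⊗ₖ σ) = 0 ∧ ((1 : Matrix n n ℂ) ⊗ₖ σ) * ρ = 0)) ∨
      suppSubset ρ ((1 : Matrix n n ℂ) ⊗ₖ σ)
  · rw [D, D, if_pos (hcond.mpr h), if_pos h, ← EReal.coe_add, EReal.coe_eq_coe_iff, DR, DR, ← hs, hsand,
      mpow_smul (posSemidef_sandwich hρ.1 hτ s) (by positivity), ← Real.rpow_mul hci0.le,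
      inv_mul_cancel₀ hα.ne', Real.rpow_one, trace_smul, smul_eq_mul, Complex.re_ofReal_mul,
      hηtr, hρ.2, Complex.one_re, div_one, div_one, Real.logb_mul hci0.ne'
        (trace_mpow_pos (posSemidef_sandwich hρ.1 hτ s)
          (sandwich_ne_zero hρ.1 hρ.ne_zero hτ h s) α).ne', Real.logb_inv]
    ring
  · rw [D, D, if_neg (fun h' => h (hcond.mp h')), if_neg h]
    rfl

theorem sInf_add_coe (S : Set EReal) (k : ℝ) :
    sInf {x | ∃ y ∈ S, x = y + (k : EReal)} = sInf S + k := by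
  apply le_antisymm
  · rw [← EReal.sub_le_iff_le_add (Or.inl (EReal.coe_ne_bot k)) (Or.inl (EReal.coe_ne_top k))]
    refine le_sInf fun y hy => ?_
    rw [EReal.sub_le_iff_le_add (Or.inl (EReal.coe_ne_bot k)) (Or.inl (EReal.coe_ne_top k))]
    exact sInf_le ⟨y, hy, rfl⟩
  · refine le_sInf ?_
    rintro x ⟨y, hy, rfl⟩
    gcongr
    exact sInf_le hy

theorem Idown_tilt {α : ℝ} (hα : 0 < α) (hα1 : α ≠ 1) {ρ : Matrix (n × m) (n × m) ℂ}
    (hρ : IsState ρ) :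
    Idown α (tilt α (ptB ρ) ρ) = -HUp α ρ
      + ((-((α - 1)⁻¹ * Real.logb 2 (mpow (ptB ρ) α).trace.re) : ℝ) : EReal) := by
  rw [HUp, neg_neg, ← sInf_add_coe, Idown]
  congr 1
  ext x
  constructor
  · rintro ⟨σ, hσ, rfl⟩
    exact ⟨_, ⟨σ, hσ, rfl⟩, D_tilt hα hα1 hρ hσ.1⟩
  · rintro ⟨_, ⟨σ, hσ, rfl⟩, rfl⟩
    exact ⟨σ, hσ, (D_tilt hα hα1 hρ hσ.1).symm⟩

theorem eq_tilt {α : ℝ} (hα1 : α ≠ 1) {r : Matrix n n ℂ} (hr : IsState r)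
    (ρ : Matrix (n × m) (n × m) ℂ) {ηA : Matrix n n ℂ}
    (hηA : ηA = ((mpow r α).trace)⁻¹ • mpow r α) :
    ((mpow ηA (1 / 2 : ℝ)) ⊗ₖ (1 : Matrix m m ℂ)) *
      (((mpow r (-(1 / 2) : ℝ)) ⊗ₖ (1 : Matrix m m ℂ)) * ρ *
        ((mpow r (-(1 / 2) : ℝ)) ⊗ₖ (1 : Matrix m m ℂ))) *
      ((mpow ηA (1 / 2 : ℝ)) ⊗ₖ (1 : Matrix m m ℂ)) = tilt α r ρ := by
  have hc := trace_mpow_pos hr.1 hr.ne_zero α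
  rw [← ofReal_trace_mpow hr.1, ← Complex.ofReal_inv] at hηA
  rw [hηA, mpow_smul (posSemidef_mpow hr.1 α) (inv_nonneg.mpr hc.le), mpow_mpow hr.1, tilt]
  set c := (mpow r α).trace.re
  have hexp : α * (1 / 2) + -(1 / 2) = (α - 1) / 2 := by ring
  have hne : α * (1 / 2) + -(1 / 2) ≠ 0 := by
    rw [hexp]
    exact div_ne_zero (sub_ne_zero.mpr hα1) two_ne_zero
  have hK : mpow r (α * (1 / 2)) * mpow r (-(1 / 2)) = mpow r ((α - 1) / 2) := by
    rw [mpow_mul_mpow hr.1 hne, hexp]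
  have hcc : ((c⁻¹ : ℝ) : ℂ) = ((c⁻¹ ^ (1 / 2 : ℝ) : ℝ) : ℂ) * ((c⁻¹ ^ (1 / 2 : ℝ) : ℝ) : ℂ) := by
    rw [← Complex.ofReal_mul, ← Real.rpow_add (inv_pos.mpr hc), add_halves, Real.rpow_one]
  have hconj : (mpow r (α * (1 / 2)) ⊗ₖ (1 : Matrix m m ℂ)) *
      ((mpow r (-(1 / 2)) ⊗ₖ (1 : Matrix m m ℂ)) * ρ *
        (mpow r (-(1 / 2)) ⊗ₖ (1 : Matrix m m ℂ))) *
      (mpow r (α * (1 / 2)) ⊗ₖ (1 : Matrix m m ℂ)) =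
      (mpow r ((α - 1) / 2) ⊗ₖ (1 : Matrix m m ℂ)) * ρ *
        (mpow r ((α - 1) / 2) ⊗ₖ (1 : Matrix m m ℂ)) := by
    have hl : (mpow r (α * (1 / 2)) ⊗ₖ (1 : Matrix m m ℂ)) *
        (mpow r (-(1 / 2)) ⊗ₖ (1 : Matrix m m ℂ)) =
        mpow r ((α - 1) / 2) ⊗ₖ (1 : Matrix m m ℂ) := by
      rw [← mul_kronecker_mul, hK, mul_one]
    have hr' : (mpow r (-(1 / 2)) ⊗ₖ (1 : Matrix m m ℂ)) *
        (mpow r (α * (1 / 2)) ⊗ₖ (1 : Matrix m m ℂ)) =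
        mpow r ((α - 1) / 2) ⊗ₖ (1 : Matrix m m ℂ) := by
      rw [← mul_kronecker_mul, mpow_commute hr.1, hK, mul_one]
    rw [Matrix.mul_assoc, Matrix.mul_assoc, Matrix.mul_assoc, hr', ← Matrix.mul_assoc, hl,
      Matrix.mul_assoc]
  rw [smul_kronecker, Matrix.smul_mul, Matrix.smul_mul, Matrix.mul_smul, smul_smul, ← hcc, hconj]

end Tilting

theorem renyi_conditional_entropy_cqmi_chain
    {A B C : Type*} [Fintype A] [DecidableEq A] [Fintype B] [DecidableEq B]
    [Fintype C] [DecidableEq C]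
    (ρ : Matrix (A × (B × C)) (A × (B × C)) ℂ) (hρ : IsState ρ)
    (α : ℝ) (hα : α ∈ Set.Ioo (0 : ℝ) 1 ∪ Set.Ioi (1 : ℝ))
    -- `η_A = ρ_A^α / Tr[ρ_A^α]` and `η_ABC = η_A^{1/2} ρ_{BC|A} η_A^{1/2}`
    (ηA : Matrix A A ℂ)
    (hηA : ηA = ((mpow (ptB ρ) α).trace)⁻¹ • mpow (ptB ρ) α)
    (ηABC : Matrix (A × (B × C)) (A × (B × C)) ℂ)
    (hηABC : ηABC = ((mpow ηA (1 / 2 : ℝ)) ⊗ₖ (1 : Matrix (B × C) (B × C) ℂ)) *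
      (((mpow (ptB ρ) (-(1 / 2) : ℝ)) ⊗ₖ (1 : Matrix (B × C) (B × C) ℂ)) * ρ *
        ((mpow (ptB ρ) (-(1 / 2) : ℝ)) ⊗ₖ (1 : Matrix (B × C) (B × C) ℂ))) *
      ((mpow ηA (1 / 2 : ℝ)) ⊗ₖ (1 : Matrix (B × C) (B × C) ℂ))) :
    -- exact identity
    (HUp α ρ = HUp α (traceOut (eAB_C A B C) ρ) - IdiffACgB α ηABC)
    ∧
    -- channel-relaxed two-sided bounds
    (∀ (R : Type) (_ : Fintype R) (_ : DecidableEq R)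
        (N : Matrix R R ℂ →ₗ[ℂ] Matrix (B × C) (B × C) ℂ)
        (ρ' : Matrix (A × R) (A × R) ℂ),
      IsCPTP N → IsState ρ' → (lext N) ρ' = ρ →
      (HUp α (traceOut (eAB_C A B C) ρ)
          - sSup {x : EReal | ∃ ω : Matrix (A × R) (A × R) ℂ,
              IsState ω ∧ x = IdiffACgB α ((lext N) ω)}
        ≤ HUp α ρ) ∧
      (HUp α ρ ≤ HUp α (traceOut (eAB_C A B C) ρ)
          - sInf {x : EReal | ∃ ω : Matrix (A × R) (A × R) ℂ,
              IsState ω ∧ x = IdiffACgB α ((lext N) ω)})) := by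
  have hα0 : 0 < α := hα.elim (fun h => h.1) fun h => zero_lt_one.trans h
  have hα1 : α ≠ 1 := hα.elim (fun h => h.2.ne) fun h => ne_of_gt h
  rw [eq_tilt hα1 hρ.ptB ρ hηA] at hηABC
  have htp : ∀ M, (ptBLinear B C M).trace = M.trace := trace_ptB
  have hptB : ptB (traceOut (eAB_C A B C) ρ) = ptB ρ := by rw [traceOut_eq_lext, ptB_lext htp]
  have hρAB : IsState (traceOut (eAB_C A B C) ρ) := by
    refine ⟨posSemidef_ptB (hρ.1.submatrix (eAB_C A B C).symm), ?_⟩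
    rw [← trace_ptB, hptB, trace_ptB, hρ.2]
  have hηAB : traceOut (eAB_C A B C) ηABC
      = tilt α (ptB (traceOut (eAB_C A B C) ρ)) (traceOut (eAB_C A B C) ρ) := by
    rw [hptB, hηABC, traceOut_eq_lext, lext_tilt, traceOut_eq_lext]
  have hid : HUp α ρ = HUp α (traceOut (eAB_C A B C) ρ) - IdiffACgB α ηABC := by
    obtain ⟨h, hh⟩ := exists_HUp_eq_coe hα hρ
    obtain ⟨h', hh'⟩ := exists_HUp_eq_coe hα hρAB
    rw [IdiffACgB, hηAB, hηABC, Idown_tilt hα0 hα1 hρ, Idown_tilt hα0 hα1 hρAB, hptB, hh, hh']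
    norm_cast
    ring
  refine ⟨hid, ?_⟩
  intro R _ _ N ρ' hN hρ' hNρ
  have hmem : IdiffACgB α ηABC ∈ {x : EReal | ∃ ω : Matrix (A × R) (A × R) ℂ,
      IsState ω ∧ x = IdiffACgB α ((lext N) ω)} := by
    refine ⟨tilt α (ptB ρ') ρ', hρ'.tilt hα0.ne', ?_⟩
    rw [hηABC, lext_tilt, hNρ, ← hNρ, ptB_lext hN.tp]
  constructor
  · rw [hid]
    exact EReal.sub_le_sub le_rfl (le_sSup hmem)
  · rw [hid]
    exact EReal.sub_le_sub le_rfl (sInf_le hmem)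

end QITLeak
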